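/- Let (X, d, μ) be a compact metric-measure space and let σ be a metric on X bi-Lipschitz equivalent to d such that μ separates points uniformly with respect to σ. Then there exists r > 0 such that every metric φ on X bi-Lipschitz equivalent to d with W_d(σ, φ) < r also has the property that μ separates points uniformly with respect to φ. (In other words, the set of metrics in the gauge of d whose canonical map into L²(μ) is bi-Lipschitz is open for the pseudometric W_d.) -/

import Mathlib

open MeasureTheory

/-- A function `σ : X → X → ℝ` is a metric on `X`. -/
def IsMetricOn {X : Type*} (σ : X → X → ℝ) : Prop :=
  (∀ x, σ x x = 0) ∧ (∀ x y, x ≠ y → 0 < σ x y) ∧ (∀ x y, σ x y = σ y x) ∧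
    (∀ x y z, σ x z ≤ σ x y + σ y z)

/-- `σ` is bi-Lipschitz equivalent to the metric `d = dist` of `X`. -/
def IsBLEquivToDist {X : Type*} [MetricSpace X] (σ : X → X → ℝ) : Prop :=
  ∃ a b : ℝ, 0 < a ∧ a ≤ b ∧ ∀ x y : X, a * dist x y ≤ σ x y ∧ σ x y ≤ b * dist x y

/-- `w(σ, φ)(x, y) = sup_z |(σ − φ)(x, z) − (σ − φ)(y, z)|`. -/
noncomputable def wFn {X : Type*} (σ φ : X → X → ℝ) (x y : X) : ℝ :=
  ⨆ z : X, |(σ x z - φ x z) - (σ y z - φ y z)|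

/-- `W_d(σ, φ) = sup_{x ≠ y} w(σ, φ)(x, y) / d(x, y)`. -/
noncomputable def Wd {X : Type*} [MetricSpace X] (σ φ : X → X → ℝ) : ℝ :=
  ⨆ q : {q : X × X // q.1 ≠ q.2}, wFn σ φ q.1.1 q.1.2 / dist q.1.1 q.1.2

/-- `μ` separates points uniformly with respect to the metric `σ`. -/
def SeparatesPointsUniformly {X : Type*} [MeasurableSpace X]
    (μ : Measure X) (σ : X → X → ℝ) : Prop :=
  ∃ ε c : ℝ, 0 < ε ∧ 0 < c ∧ ∀ x y : X,
    c ≤ (μ {z : X | ε * σ x y ≤ |σ x z - σ y z|}).toReal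

/-- Reverse triangle inequality. -/
lemma IsMetricOn.abs_sub_le {X : Type*} {σ : X → X → ℝ} (hσ : IsMetricOn σ) (x y z : X) :
    |σ x z - σ y z| ≤ σ x y := by
  obtain ⟨-, -, hsymm, htri⟩ := hσ
  have h₁ := htri x y z
  have h₂ := htri y x z
  have h₃ := hsymm x y
  exact abs_le.2 ⟨by linarith, by linarith⟩

/-- The increments of `σ - φ` are controlled by `Wd σ φ`; in particular, both suprema in the
definition of `Wd` are suprema of bounded families. -/
lemma abs_sub_sub_le_Wd_mul_dist {X : Type*} [MetricSpace X] {σ φ : X → X → ℝ}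
    (hσ : IsMetricOn σ) (hσd : IsBLEquivToDist σ) (hφ : IsMetricOn φ) (hφd : IsBLEquivToDist φ)
    (x y z : X) :
    |(σ x z - φ x z) - (σ y z - φ y z)| ≤ Wd σ φ * dist x y := by
  rcases eq_or_ne x y with rfl | hxy
  · simp
  obtain ⟨_, b, -, -, hb⟩ := hσd
  obtain ⟨_, B, -, -, hB⟩ := hφd
  have key (x y z : X) : |(σ x z - φ x z) - (σ y z - φ y z)| ≤ (b + B) * dist x y := by
    have h₁ := abs_le.1 (hσ.abs_sub_le x y z)
    have h₂ := abs_le.1 (hφ.abs_sub_le x y z)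
    have h₃ := (hb x y).2
    have h₄ := (hB x y).2
    exact abs_le.2 ⟨by linarith, by linarith⟩
  have hw : |(σ x z - φ x z) - (σ y z - φ y z)| ≤ wFn σ φ x y :=
    le_ciSup (f := fun z ↦ |(σ x z - φ x z) - (σ y z - φ y z)|)
      ⟨(b + B) * dist x y, by rintro _ ⟨z, rfl⟩; exact key x y z⟩ z
  have hW : wFn σ φ x y / dist x y ≤ Wd σ φ := by
    refine le_ciSup (f := fun q : {q : X × X // q.1 ≠ q.2} ↦
      wFn σ φ q.1.1 q.1.2 / dist q.1.1 q.1.2) ⟨b + B, ?_⟩ ⟨(x, y), hxy⟩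
    rintro _ ⟨⟨⟨u, v⟩, huv⟩, rfl⟩
    have : Nonempty X := ⟨u⟩
    exact (div_le_iff₀ (dist_pos.2 huv)).2 (ciSup_le (key u v))
  exact hw.trans ((div_le_iff₀ (dist_pos.2 hxy)).1 hW)

/-- **Lemma `strctsmll`.** Let `(X, d, μ)` be a compact metric-measure
space and `σ` a metric on `X` bi-Lipschitz equivalent to `d` with respect to which `μ`
separates points uniformly.  Then there is `r > 0` such that every metric `φ`
bi-Lipschitz equivalent to `d` with `W_d(σ, φ) < r` also has this property: the set of
metrics in the gauge of `d` with bi-Lipschitz canonical map is `W_d`-open. -/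
theorem uniform_separation_open_in_gauge
    {X : Type*} [MetricSpace X] [CompactSpace X]
    [MeasurableSpace X] [BorelSpace X]
    (μ : Measure X) [IsFiniteMeasure μ] [μ.Regular] [μ.IsOpenPosMeasure]
    (σ : X → X → ℝ) (hσ : IsMetricOn σ) (hσd : IsBLEquivToDist σ)
    (hsep : SeparatesPointsUniformly μ σ) :
    ∃ r : ℝ, 0 < r ∧ ∀ φ : X → X → ℝ, IsMetricOn φ → IsBLEquivToDist φ →
      Wd σ φ < r → SeparatesPointsUniformly μ φ := by
  obtain ⟨a, b, ha, hab, hσa⟩ := hσd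
  obtain ⟨ε, c, hε, hc, hsep⟩ := hsep
  refine ⟨ε * a / 2, by positivity, fun φ hφ hφd hW ↦ ?_⟩
  obtain ⟨A, B, hA, hAB, hφB⟩ := hφd
  have hB : 0 < B := hA.trans_le hAB
  refine ⟨ε * a / 2 / B, c, by positivity, hc, fun x y ↦ (hsep x y).trans ?_⟩
  refine ENNReal.toReal_mono (measure_ne_top _ _) (measure_mono fun z hz ↦ ?_)
  simp only [Set.mem_ofPred_eq] at hz ⊢
  have hd : |(σ x z - φ x z) - (σ y z - φ y z)| ≤ ε * a / 2 * dist x y :=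
    (abs_sub_sub_le_Wd_mul_dist hσ ⟨a, b, ha, hab, hσa⟩ hφ ⟨A, B, hA, hAB, hφB⟩ x y z).trans
      (by gcongr)
  have hσ_lower : ε * (a * dist x y) ≤ ε * σ x y := by gcongr; exact (hσa x y).1
  have hφ_upper : ε * a / 2 / B * φ x y ≤ ε * a / 2 * dist x y := by
    calc ε * a / 2 / B * φ x y ≤ ε * a / 2 / B * (B * dist x y) := by
          gcongr; exact (hφB x y).2
      _ = ε * a / 2 * dist x y := by field_simp
  have htri : |σ x z - σ y z| ≤
      |(σ x z - φ x z) - (σ y z - φ y z)| + |φ x z - φ y z| := by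
    have h := abs_add_le ((σ x z - φ x z) - (σ y z - φ y z)) (φ x z - φ y z)
    rwa [show (σ x z - φ x z) - (σ y z - φ y z) + (φ x z - φ y z) = σ x z - σ y z by ring] at h
  linarith
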